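/- Let E be a real inner product space and L : E → ℝ differentiable, μ-strongly convex and with ρ-Lipschitz gradient, 0 < μ ≤ ρ, with global minimizer w*. Fix w, ŵ, e ∈ E, set ζ = ŵ − w, and let w⁺ = w − (1/ρ)(∇L(w) + e). Then L(w⁺) − L(w*) ≤ L(w) − L(w*) + (μ/ρ)[⟪ζ, ∇L(w)⟫ + (ρ/2)‖ζ‖²] + (μ/ρ)(L(w*) − L(ŵ)) + (1/(2ρ))‖e‖². -/

import Mathlib

open scoped RealInnerProductSpace

/-- Descent lemma: a function with `ρ`-Lipschitz gradient lies below its quadratic upper model. -/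
theorem le_quadratic_model_of_lipschitz_gradient
    {E : Type*} [NormedAddCommGroup E] [InnerProductSpace ℝ E] [CompleteSpace E]
    {L : E → ℝ} {g : E → E} {ρ : ℝ} (hdiff : ∀ x : E, HasGradientAt L (g x) x)
    (hlip : ∀ x y : E, ‖g x - g y‖ ≤ ρ * ‖x - y‖) (x d : E) :
    L (x + d) ≤ L x + ⟪d, g x⟫ + ρ / 2 * ‖d‖ ^ 2 := by
  have hφ : ∀ t : ℝ, HasDerivAt
      (fun t : ℝ => L (x + t • d) - t * ⟪d, g x⟫ - ρ / 2 * ‖d‖ ^ 2 * t ^ 2)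
      (⟪g (x + t • d), d⟫ - ⟪d, g x⟫ - ρ * ‖d‖ ^ 2 * t) t := by
    intro t
    have hline : HasDerivAt (fun t : ℝ => x + t • d) d t := by
      simpa using ((hasDerivAt_id t).smul_const d).const_add x
    have hL : HasDerivAt (fun t : ℝ => L (x + t • d)) ⟪g (x + t • d), d⟫ t := by
      simpa [Function.comp_def] using
        (hdiff (x + t • d)).hasFDerivAt.comp_hasDerivAt t hline
    have hlin : HasDerivAt (fun t : ℝ => t * ⟪d, g x⟫) ⟪d, g x⟫ t := by
      simpa using (hasDerivAt_id t).mul_const ⟪d, g x⟫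
    have hquad := (hasDerivAt_pow 2 t).const_mul (ρ / 2 * ‖d‖ ^ 2)
    refine ((hL.sub hlin).sub hquad).congr_deriv ?_
    norm_num
    ring
  have hanti := antitoneOn_of_hasDerivWithinAt_nonpos (convex_Icc (0 : ℝ) 1)
    (fun t _ => (hφ t).continuousAt.continuousWithinAt)
    (fun t _ => (hφ t).hasDerivWithinAt) (fun t ht => by
      have ht0 : 0 ≤ t := (interior_subset ht).1
      have hcs := real_inner_le_norm (g (x + t • d) - g x) d
      have hl := hlip (x + t • d) x
      rw [add_sub_cancel_left, norm_smul, Real.norm_of_nonneg ht0] at hl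
      have hm := mul_le_mul_of_nonneg_right hl (norm_nonneg d)
      rw [inner_sub_left, real_inner_comm d (g x)] at hcs
      linarith)
  have h := hanti (Set.left_mem_Icc.2 zero_le_one) (Set.right_mem_Icc.2 zero_le_one) zero_le_one
  simp only [one_smul, zero_smul, add_zero] at h
  linarith

/-- Polyak–Łojasiewicz inequality: a strong convexity bound at `x` controls the gap to any value. -/
theorem two_mul_sub_le_norm_gradient_sq
    {E : Type*} [NormedAddCommGroup E] [InnerProductSpace ℝ E]
    {a b μ : ℝ} (hμ : 0 < μ) {d v : E} (h : a + ⟪d, v⟫ + μ / 2 * ‖d‖ ^ 2 ≤ b) :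
    2 * μ * (a - b) ≤ ‖v‖ ^ 2 := by
  have hsq := sq_nonneg ‖μ • d + v‖
  rw [norm_add_sq_real, norm_smul, inner_smul_left, Real.norm_of_nonneg hμ.le] at hsq
  simp only [conj_trivial] at hsq
  have hm := mul_le_mul_of_nonneg_left h (by positivity : 0 ≤ 2 * μ)
  linarith

/-- Inequality (c) in the proof of the USD-FL optimality-gap theorem. -/
theorem usd_fl_optimality_gap_step_c
    {E : Type*} [NormedAddCommGroup E] [InnerProductSpace ℝ E] [CompleteSpace E]
    (L : E → ℝ) (g : E → E) (μ ρ : ℝ) (hμ : 0 < μ) (hμρ : μ ≤ ρ)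
    (hdiff : ∀ x : E, HasGradientAt L (g x) x)
    (hconv : ∀ w w' : E, L w' ≥ L w + ⟪w' - w, g w⟫ + μ / 2 * ‖w' - w‖ ^ 2)
    (hlip : ∀ w w' : E, ‖g w - g w'‖ ≤ ρ * ‖w - w'‖)
    (wstar : E) (hmin : ∀ w : E, L wstar ≤ L w)
    (w wHat e : E) :
    L (w - (1 / ρ) • (g w + e)) - L wstar ≤
      L w - L wstar
        + μ / ρ * (⟪wHat - w, g w⟫ + ρ / 2 * ‖wHat - w‖ ^ 2)
        + μ / ρ * (L wstar - L wHat)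
        + 1 / (2 * ρ) * ‖e‖ ^ 2 := by
  have hρ : 0 < ρ := hμ.trans_le hμρ
  have hstep : L (w - (1 / ρ) • (g w + e)) ≤
      L w - 1 / (2 * ρ) * ‖g w‖ ^ 2 + 1 / (2 * ρ) * ‖e‖ ^ 2 := by
    have h := le_quadratic_model_of_lipschitz_gradient hdiff hlip w (-((1 / ρ) • (g w + e)))
    rw [← sub_eq_add_neg, norm_neg, inner_neg_left, norm_smul, inner_smul_left, inner_add_left,
      Real.norm_of_nonneg (by positivity), mul_pow, norm_add_sq_real,
      real_inner_self_eq_norm_sq, real_inner_comm] at h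
    simp only [conj_trivial] at h
    refine h.trans_eq ?_
    field_simp
    ring
  have hPL := two_mul_sub_le_norm_gradient_sq hμ (hconv w wstar)
  have hPL' : μ / ρ * (L w - L wstar) ≤ 1 / (2 * ρ) * ‖g w‖ ^ 2 := by
    refine le_trans (le_of_eq ?_)
      (mul_le_mul_of_nonneg_left hPL (by positivity : 0 ≤ 1 / (2 * ρ)))
    field_simp
  have hHat := le_quadratic_model_of_lipschitz_gradient hdiff hlip w (wHat - w)
  rw [add_sub_cancel] at hHat
  have hHat' := mul_le_mul_of_nonneg_left hHat (by positivity : 0 ≤ μ / ρ)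
  linarith
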